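/- Let R be a commutative ring and I a proper ideal of R. If the R⋈I-module surjection ε : R⋈I → R, (r, r+i) ↦ r, admits an R⋈I-module section π : R → R⋈I with π(1) = (1, 1+j), then i(1+j) = 0 for every i ∈ I, the ideal I equals Rj², and j² is an idempotent element of R. -/

import Mathlib

/-- The amalgamated duplication of a commutative ring `R` along an ideal `I`,
realized as the subring `{(x, y) ∈ R × R : y - x ∈ I}` of `R × R`. -/
def amalgDup (R : Type*) [CommRing R] (I : Ideal R) : Subring (R × R) where
  carrier := {p | p.2 - p.1 ∈ I}
  zero_mem' := by simp
  one_mem' := by simp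
  add_mem' := by
    intro a b ha hb
    have := I.add_mem ha hb
    simpa [add_sub_add_comm] using this
  neg_mem' := by
    intro a ha
    show -a.2 - -a.1 ∈ I
    have h : -a.2 - -a.1 = -(a.2 - a.1) := by ring
    rw [h]; exact I.neg_mem ha
  mul_mem' := by
    intro a b ha hb
    have : a.2 * b.2 - a.1 * b.1 = (a.2 - a.1) * b.2 + a.1 * (b.2 - b.1) := by ring
    show a.2 * b.2 - a.1 * b.1 ∈ I
    rw [this]
    exact I.add_mem (I.mul_mem_right _ ha) (I.mul_mem_left _ hb)

/-- A commutative ring is quasi-Frobenius if it is Noetherian and self-injective. -/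
def IsQuasiFrobenius (R : Type*) [CommRing R] : Prop :=
  IsNoetherianRing R ∧ Module.Injective R R

/-- The canonical surjection `ε : R⋈I → R`, `(r, r+i) ↦ r`. -/
def epsHom (R : Type*) [CommRing R] (I : Ideal R) : amalgDup R I →+* R :=
  (RingHom.fst R R).comp (amalgDup R I).subtype

/-- `R` as a module over `R⋈I` via the surjection `ε`. -/
instance epsModule (R : Type*) [CommRing R] (I : Ideal R) :
    Module (amalgDup R I) R :=
  Module.compHom R (epsHom R I)

theorem span_idempotent_of_section (R : Type*) [CommRing R] (I : Ideal R)
    (hI : I ≠ ⊤) (j : R) (π : R →ₗ[amalgDup R I] amalgDup R I)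
    (hsec : ∀ r : R, epsHom R I (π r) = r)
    (hπ1 : (π 1 : R × R) = (1, 1 + j)) :
    (∀ i ∈ I, i * (1 + j) = 0) ∧ I = Ideal.span {j * j} ∧
      (j * j) * (j * j) = j * j := by
  have hj : j ∈ I := by
    have h : (π 1 : R × R).2 - (π 1 : R × R).1 ∈ I := (π 1).2
    simpa [hπ1] using h
  have hann : ∀ i ∈ I, i * (1 + j) = 0 := by
    intro i hi
    let a : amalgDup R I := ⟨(0, i), show i - 0 ∈ I by simpa using hi⟩
    have ha : a • (1 : R) = 0 := show (0 : R) * 1 = 0 from zero_mul 1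
    have h : a * π 1 = 0 := by rw [← smul_eq_mul, ← map_smul, ha, map_zero]
    have h2 : i * (π 1 : R × R).2 = 0 := congrArg (fun p : amalgDup R I => (p : R × R).2) h
    simpa only [hπ1] using h2
  have hjj := hann j hj
  refine ⟨hann, le_antisymm (fun i hi => ?_) ?_, ?_⟩
  · rw [Ideal.mem_span_singleton']
    exact ⟨i, by linear_combination (j - 1) * hann i hi⟩
  · rw [Ideal.span_singleton_le_iff_mem]
    exact I.mul_mem_left j hj
  · linear_combination (j * j - j) * hjj
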